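/- Let f be a non-constant Boolean function with s_1(f) = 2. Then C_0(f) ≤ (9/5)·s_0(f). -/

import Mathlib

/-- The input `x` with its `i`-th coordinate flipped. -/
def flipCoord {n : ℕ} (x : Fin n → Bool) (i : Fin n) : Fin n → Bool :=
  Function.update x i (!(x i))

/-- The sensitivity `s(f, x)` of a Boolean function `f` on input `x`:
the number of coordinates whose flip changes the value of `f`. -/
def sensAt {n : ℕ} (f : (Fin n → Bool) → Bool) (x : Fin n → Bool) : ℕ :=
  (Finset.univ.filter fun i => f (flipCoord x i) ≠ f x).card

/-- The `b`-sensitivity `s_b(f)`: the maximum of `s(f, x)` over inputs `x` with `f x = b`. -/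
def bSens {n : ℕ} (f : (Fin n → Bool) → Bool) (b : Bool) : ℕ :=
  (Finset.univ.filter fun x => f x = b).sup (sensAt f)

/-- The certificate complexity `C(f, x)`: the minimum size of a set `P` of coordinates
such that fixing the coordinates in `P` to their values in `x` forces the value of `f`. -/
noncomputable def certAt {n : ℕ} (f : (Fin n → Bool) → Bool) (x : Fin n → Bool) : ℕ :=
  sInf {k | ∃ P : Finset (Fin n), P.card = k ∧
    ∀ y : Fin n → Bool, (∀ i ∈ P, y i = x i) → f y = f x}

/-- The `b`-certificate complexity `C_b(f)`: the maximum of `C(f, x)` over `x` with `f x = b`. -/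
noncomputable def bCert {n : ℕ} (f : (Fin n → Bool) → Bool) (b : Bool) : ℕ :=
  (Finset.univ.filter fun x => f x = b).sup (certAt f)

/-- A Boolean function is non-constant if it takes two different values. -/
def NonConstant {n : ℕ} (f : (Fin n → Bool) → Bool) : Prop :=
  ∃ x y, f x ≠ f y

section FlipCoord

variable {n : ℕ}

theorem flipCoord_same (x : Fin n → Bool) (i : Fin n) : flipCoord x i i = !(x i) := by
  simp [flipCoord]

theorem flipCoord_of_ne (x : Fin n → Bool) {i k : Fin n} (h : k ≠ i) :
    flipCoord x i k = x k := by
  simp [flipCoord, h]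

theorem flipCoord_flipCoord (x : Fin n → Bool) (i : Fin n) :
    flipCoord (flipCoord x i) i = x := by
  simp [flipCoord]

theorem flipCoord_comm (x : Fin n → Bool) (i k : Fin n) :
    flipCoord (flipCoord x i) k = flipCoord (flipCoord x k) i := by
  by_cases h : i = k
  · rw [h]
  · funext l
    simp only [flipCoord, Function.update_apply]
    grind

/-- Half of a set of inputs closed under flipping coordinate `d` satisfies `x d = b`. -/
theorem two_mul_card_filter_and_eq (A : (Fin n → Bool) → Prop) [DecidablePred A] (d : Fin n)
    (b : Bool) (hA : ∀ x, A (flipCoord x d) ↔ A x) :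
    2 * (Finset.univ.filter fun x => A x ∧ x d = b).card = (Finset.univ.filter A).card := by
  have h₁ : (Finset.univ.filter fun x => A x ∧ x d = b).card =
      (Finset.univ.filter fun x => A x ∧ ¬ x d = b).card := by
    refine Finset.card_nbij' (fun x => flipCoord x d) (fun x => flipCoord x d) ?_ ?_ ?_ ?_
    · intro x hx
      simp only [Finset.coe_filter, Finset.mem_univ, true_and, Set.mem_ofPred_eq] at hx ⊢
      rw [hA, flipCoord_same]
      exact ⟨hx.1, Bool.not_eq.1 (by rw [Bool.not_not, hx.2])⟩
    · intro x hx
      simp only [Finset.coe_filter, Finset.mem_univ, true_and, Set.mem_ofPred_eq] at hx ⊢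
      rw [hA, flipCoord_same]
      exact ⟨hx.1, Bool.not_eq.2 hx.2⟩
    · intro x _
      exact flipCoord_flipCoord x d
    · intro x _
      exact flipCoord_flipCoord x d
  have h₂ := Finset.card_filter_add_card_filter_not (s := Finset.univ.filter A)
    (fun x : Fin n → Bool => x d = b)
  rw [Finset.filter_filter, Finset.filter_filter] at h₂
  omega

end FlipCoord

section SensitivityOne

variable {n : ℕ} {g : (Fin n → Bool) → Bool}

/-- The neighbours of a `0`-input `v` of a function of `1`-sensitivity at most one determine
the function on the subcube through `v` spanned by the insensitive coordinates. -/
theorem eq_false_and_flipCoord_iff_of_agree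
    (hg : ∀ x, g x = true → ∀ i k, g (flipCoord x i) = false → g (flipCoord x k) = false → i = k)
    {v : Fin n → Bool} (hv : g v = false) (x : Fin n → Bool)
    (hx : ∀ d, g (flipCoord v d) = true → x d = v d) :
    g x = false ∧ ∀ d, g (flipCoord x d) = true ↔ g (flipCoord v d) = true := by
  classical
  have step : ∀ (y : Fin n → Bool) (k : Fin n), ¬ g (flipCoord v k) = true →
      (g y = false ∧ ∀ d, g (flipCoord y d) = true ↔ g (flipCoord v d) = true) →
      (g (flipCoord y k) = false ∧
        ∀ d, g (flipCoord (flipCoord y k) d) = true ↔ g (flipCoord v d) = true) := by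
    rintro y k hk ⟨hy, hyd⟩
    have hyk : g (flipCoord y k) = false := by
      have := hyd k
      grind
    refine ⟨hyk, fun d => ?_⟩
    by_cases hdk : d = k
    · subst hdk
      rw [flipCoord_flipCoord]
      grind
    rw [← hyd d]
    constructor
    · intro h
      by_contra hne
      refine hdk (hg _ h d k ?_ ?_)
      · rw [flipCoord_flipCoord]
        exact hyk
      · rw [flipCoord_comm y k d, flipCoord_flipCoord]
        simpa using hne
    · intro h
      by_contra hne
      refine hdk (hg _ h d k ?_ ?_)
      · rw [flipCoord_flipCoord]
        exact hy
      · rw [flipCoord_comm y d k]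
        simpa using hne
  have key : ∀ s : Finset (Fin n),
      g (s.piecewise x v) = false ∧
        ∀ d, g (flipCoord (s.piecewise x v) d) = true ↔ g (flipCoord v d) = true := by
    intro s
    induction s using Finset.induction with
    | empty => simp [hv]
    | insert k s hks ih =>
      rw [Finset.piecewise_insert]
      by_cases hxk : x k = v k
      · have : Function.update (s.piecewise x v) k (x k) = s.piecewise x v := by
          rw [Function.update_eq_self_iff, hxk]
          simp [hks]
        rwa [this]
      · have : Function.update (s.piecewise x v) k (x k) = flipCoord (s.piecewise x v) k := by
          unfold flipCoord
          congr 1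
          rw [Finset.piecewise_eq_of_notMem _ _ _ hks]
          revert hxk
          cases x k <;> cases v k <;> simp
        rw [this]
        exact step _ k (fun h => hxk (hx k h)) ih
  simpa using key Finset.univ

/-- A function of `1`-sensitivity at most one that is not identically `0` is either a literal or
takes the value `1` on at least three quarters of the cube. -/
theorem literal_or_three_quarters
    (hg : ∀ x, g x = true → ∀ i k, g (flipCoord x i) = false → g (flipCoord x k) = false → i = k)
    (hne : ∃ x, g x = true) :
    (∃ d b, ∀ x, g x = (x d == b)) ∨
      3 * 2 ^ n ≤ 4 * (Finset.univ.filter fun x => g x = true).card := by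
  classical
  have htot : (Finset.univ.filter fun x => g x = true).card +
      (Finset.univ.filter fun x => g x = false).card = 2 ^ n := by
    have h := Finset.card_filter_add_card_filter_not
      (s := (Finset.univ : Finset (Fin n → Bool))) (fun x => g x = true)
    simpa using h
  by_cases hall : ∀ v, g v = false →
      3 ≤ (Finset.univ.filter fun i => g (flipCoord v i) = true).card
  · right
    have hcount : ∑ v ∈ Finset.univ.filter (fun x => g x = false),
          (Finset.univ.filter fun i => g (flipCoord v i) = true).card =
        ∑ w ∈ Finset.univ.filter (fun x => g x = true),
          (Finset.univ.filter fun i => g (flipCoord w i) = false).card := by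
      rw [← Finset.card_sigma, ← Finset.card_sigma]
      refine Finset.card_nbij' (fun p => ⟨flipCoord p.1 p.2, p.2⟩)
        (fun p => ⟨flipCoord p.1 p.2, p.2⟩) ?_ ?_ ?_ ?_
      · rintro ⟨v, i⟩ h
        simpa [flipCoord_flipCoord, and_comm] using h
      · rintro ⟨v, i⟩ h
        simpa [flipCoord_flipCoord, and_comm] using h
      · rintro ⟨v, i⟩ _
        simp [flipCoord_flipCoord]
      · rintro ⟨v, i⟩ _
        simp [flipCoord_flipCoord]
    have hlow := Finset.card_nsmul_le_sum (Finset.univ.filter fun x => g x = false)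
      (fun v => (Finset.univ.filter fun i => g (flipCoord v i) = true).card) 3
      (fun v h => hall v (by simpa using h))
    have hupp := Finset.sum_le_card_nsmul (Finset.univ.filter fun x => g x = true)
      (fun w => (Finset.univ.filter fun i => g (flipCoord w i) = false).card) 1
      (fun w h => Finset.card_le_one.2 fun i hi k hk =>
        hg w (by simpa using h) i k (by simpa using hi) (by simpa using hk))
    simp only [smul_eq_mul] at hlow hupp
    omega
  · push Not at hall
    obtain ⟨v, hv, hcard⟩ := hall
    have hcube := eq_false_and_flipCoord_iff_of_agree hg hv
    have hN : ∀ d, g (flipCoord v d) = true ↔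
        d ∈ Finset.univ.filter fun i => g (flipCoord v i) = true := by simp
    generalize (Finset.univ.filter fun i => g (flipCoord v i) = true) = N at hcard hN
    simp only [hN] at hcube
    obtain h0 | h1 | h2 : N.card = 0 ∨ N.card = 1 ∨ N.card = 2 := by omega
    · exfalso
      obtain ⟨x, hx⟩ := hne
      rw [Finset.card_eq_zero] at h0
      subst h0
      have := (hcube x (by simp)).1
      simp [hx] at this
    · left
      obtain ⟨d, rfl⟩ := Finset.card_eq_one.1 h1
      refine ⟨d, !(v d), fun x => ?_⟩
      by_cases hxd : x d = v d
      · rw [(hcube x (by simpa using hxd)).1, hxd]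
        simp
      · have h := (hcube (flipCoord x d)
          (by simpa only [Finset.mem_singleton, forall_eq, flipCoord_same] using Bool.not_eq.2 hxd)).2 d
        rw [flipCoord_flipCoord] at h
        rw [h.2 (by simp)]
        rw [Bool.eq_not.2 hxd, beq_self_eq_true]
    · right
      obtain ⟨d, e, hde, rfl⟩ := Finset.card_eq_two.1 h2
      have hone : ∀ (x : Fin n → Bool) (d e : Fin n), d ≠ e →
          (∀ y, y d = v d → y e = v e → g y = false ∧ g (flipCoord y d) = true ∧
            g (flipCoord y e) = true) → ¬ x d = v d → g x = true := by
        intro x d e hde hcube hxd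
        have hxd' : flipCoord x d d = v d := by rw [flipCoord_same, Bool.not_eq.2 hxd]
        by_cases hxe : x e = v e
        · have h := (hcube (flipCoord x d) hxd' (by rwa [flipCoord_of_ne _ hde.symm])).2.1
          rwa [flipCoord_flipCoord] at h
        · have hxe' : flipCoord (flipCoord x d) e e = v e := by
            rw [flipCoord_same, flipCoord_of_ne _ hde.symm, Bool.not_eq.2 hxe]
          have h := hcube (flipCoord (flipCoord x d) e) (by rwa [flipCoord_of_ne _ hde]) hxe'
          have h' := h.2.2
          rw [flipCoord_flipCoord] at h'
          by_contra hgx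
          refine hde (hg _ h' d e ?_ h.1)
          rw [flipCoord_flipCoord]
          simpa using hgx
      have hsub : (Finset.univ.filter fun x => g x = false) ⊆
          Finset.univ.filter fun x => x d = v d ∧ x e = v e := by
        intro x hx
        simp only [Finset.mem_filter, Finset.mem_univ, true_and] at hx ⊢
        have hall : ∀ y, y d = v d → y e = v e → g y = false ∧ g (flipCoord y d) = true ∧
            g (flipCoord y e) = true := by
          intro y hyd hye
          have h := hcube y (by simp [hyd, hye])
          exact ⟨h.1, (h.2 d).2 (by simp), (h.2 e).2 (by simp)⟩
        constructor
        · by_contra h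
          have := hone x d e hde hall h
          simp [hx] at this
        · by_contra h
          have := hone x e d hde.symm
            (fun y h₁ h₂ => ⟨(hall y h₂ h₁).1, (hall y h₂ h₁).2.2, (hall y h₂ h₁).2.1⟩) h
          simp [hx] at this
      have hle := Finset.card_le_card hsub
      have e₁ := two_mul_card_filter_and_eq (fun x => x d = v d) e (v e)
        (fun x => by rw [flipCoord_of_ne _ hde])
      have e₂ := two_mul_card_filter_and_eq (fun _ : Fin n → Bool => True) d (v d) (fun _ => Iff.rfl)
      simp only [true_and, Finset.filter_true, Finset.card_univ, Fintype.card_pi,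
        Fintype.card_bool, Finset.prod_const, Fintype.card_fin] at e₂
      omega

/-- A function of `1`-sensitivity at most one that is not identically `0` takes the value `1` on
at least half of the cube. -/
theorem two_pow_le_two_mul_card
    (hg : ∀ x, g x = true → ∀ i k, g (flipCoord x i) = false → g (flipCoord x k) = false → i = k)
    (hne : ∃ x, g x = true) :
    2 ^ n ≤ 2 * (Finset.univ.filter fun x => g x = true).card := by
  rcases literal_or_three_quarters hg hne with ⟨d, b, h⟩ | h
  · have e := two_mul_card_filter_and_eq (fun _ : Fin n → Bool => True) d b (fun _ => Iff.rfl)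
    simp only [true_and, Finset.filter_true, Finset.card_univ, Fintype.card_pi,
      Fintype.card_bool, Finset.prod_const, Fintype.card_fin] at e
    simp only [h, beq_iff_eq]
    exact e.ge
  · omega

end SensitivityOne

section Certificates

variable {n : ℕ}

/-- `P` is the set of positions of a certificate of `f` on the input `z`. -/
def IsCert (f : (Fin n → Bool) → Bool) (z : Fin n → Bool) (P : Finset (Fin n)) : Prop :=
  ∀ y : Fin n → Bool, (∀ i ∈ P, y i = z i) → f y = f z

/-- `P` is a certificate of `f` on `z` of minimum size. -/
def IsMinCert (f : (Fin n → Bool) → Bool) (z : Fin n → Bool) (P : Finset (Fin n)) : Prop :=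
  IsCert f z P ∧ ∀ Q, IsCert f z Q → P.card ≤ Q.card

/-- The restriction of `f` to the `i`-th neighbour of the subcube `{y | ∀ k ∈ P, y k = z k}`,
as a function on the whole cube that ignores the coordinates in `P`. -/
def neighbour (f : (Fin n → Bool) → Bool) (z : Fin n → Bool) (P : Finset (Fin n)) (i : Fin n)
    (x : Fin n → Bool) : Bool :=
  f (flipCoord (P.piecewise z x) i)

variable {f : (Fin n → Bool) → Bool} {z : Fin n → Bool} {P : Finset (Fin n)} {i : Fin n}

theorem piecewise_flipCoord_of_mem {k : Fin n} (hk : k ∈ P) (x : Fin n → Bool) :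
    P.piecewise z (flipCoord x k) = P.piecewise z x := by
  funext l
  by_cases hl : l ∈ P
  · simp [hl]
  · simp only [hl, not_false_eq_true, Finset.piecewise_eq_of_notMem]
    exact flipCoord_of_ne _ (fun h => hl (h ▸ hk))

theorem piecewise_flipCoord_of_notMem {k : Fin n} (hk : k ∉ P) (x : Fin n → Bool) :
    P.piecewise z (flipCoord x k) = flipCoord (P.piecewise z x) k := by
  funext l
  by_cases hlk : l = k
  · subst hlk
    simp [hk, flipCoord_same]
  · rw [flipCoord_of_ne _ hlk]
    by_cases hl : l ∈ P
    · simp [hl]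
    · simp [hl, flipCoord_of_ne _ hlk]

theorem neighbour_flipCoord_of_mem {k : Fin n} (hk : k ∈ P) (x : Fin n → Bool) :
    neighbour f z P i (flipCoord x k) = neighbour f z P i x := by
  unfold neighbour
  rw [piecewise_flipCoord_of_mem hk]

theorem neighbour_self : neighbour f z P i z = f (flipCoord z i) := by
  simp [neighbour, Finset.piecewise_same]

theorem neighbour_flipCoord_self {k : Fin n} (hk : k ∉ P) :
    neighbour f z P i (flipCoord z k) = f (flipCoord (flipCoord z k) i) := by
  simp [neighbour, piecewise_flipCoord_of_notMem hk, Finset.piecewise_same]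

theorem notMem_of_neighbour_eq_literal {d : Fin n} {b : Bool}
    (h : ∀ x, neighbour f z P i x = (x d == b)) : d ∉ P := by
  intro hd
  have h₁ := h z
  have h₂ := h (flipCoord z d)
  rw [neighbour_flipCoord_of_mem hd, h₁, flipCoord_same] at h₂
  revert h₂
  cases z d <;> cases b <;> simp

/-- An input agreeing with `z` on `P` except at `i ∈ P` lies in the `i`-th neighbour. -/
theorem apply_eq_neighbour (hi : i ∈ P) {y : Fin n → Bool} (hyi : y i ≠ z i)
    (hy : ∀ k ∈ P, k ≠ i → y k = z k) : f y = neighbour f z P i y := by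
  unfold neighbour
  congr 1
  funext k
  by_cases hk : k = i
  · subst hk
    rw [flipCoord_same, Finset.piecewise_eq_of_mem _ _ _ hi]
    revert hyi
    cases y k <;> cases z k <;> simp
  · rw [flipCoord_of_ne _ hk]
    by_cases hkP : k ∈ P
    · simp [hkP, hy k hkP hk]
    · simp [hkP]

theorem IsCert.apply_piecewise (h : IsCert f z P) (x : Fin n → Bool) :
    f (P.piecewise z x) = f z :=
  h _ fun k hk => by simp [hk]

theorem card_le_two_of_sensitive (hs1 : ∀ x, f x = true → sensAt f x ≤ 2) {x : Fin n → Bool}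
    (hx : f x = true) (s : Finset (Fin n)) (hs : ∀ k ∈ s, f (flipCoord x k) = false) :
    s.card ≤ 2 := by
  refine le_trans (Finset.card_le_card fun k hk => ?_) (hs1 x hx)
  simp [hs k hk, hx]

theorem neighbour_sensitivity (hs1 : ∀ x, f x = true → sensAt f x ≤ 2) (hz : f z = false)
    (hP : IsCert f z P) (hi : i ∈ P) (x : Fin n → Bool) (hx : neighbour f z P i x = true)
    (k l : Fin n) (hk : neighbour f z P i (flipCoord x k) = false)
    (hl : neighbour f z P i (flipCoord x l) = false) : k = l := by
  by_contra hkl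
  have aux : ∀ k, neighbour f z P i (flipCoord x k) = false →
      k ≠ i ∧ f (flipCoord (flipCoord (P.piecewise z x) i) k) = false := by
    intro k hk
    have hkP : k ∉ P := by
      intro h
      rw [neighbour_flipCoord_of_mem h, hx] at hk
      simp at hk
    rw [neighbour, piecewise_flipCoord_of_notMem hkP, flipCoord_comm] at hk
    exact ⟨fun h => hkP (h ▸ hi), hk⟩
  obtain ⟨hki, hk'⟩ := aux k hk
  obtain ⟨hli, hl'⟩ := aux l hl
  have hcard := card_le_two_of_sensitive hs1 hx {i, k, l} (by
    intro t ht
    simp only [Finset.mem_insert, Finset.mem_singleton] at ht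
    rcases ht with rfl | rfl | rfl
    · rw [flipCoord_flipCoord, hP.apply_piecewise, hz]
    · exact hk'
    · exact hl')
  rw [Finset.card_eq_three.2 ⟨i, k, l, hki.symm, hli.symm, hkl, rfl⟩] at hcard
  omega

theorem IsMinCert.exists_neighbour_eq_true (hP : IsMinCert f z P) (hz : f z = false)
    (hi : i ∈ P) : ∃ x, neighbour f z P i x = true := by
  by_contra! hcon
  have hcert : IsCert f z (P.erase i) := by
    intro y hy
    by_cases hyi : y i = z i
    · refine hP.1 y fun k hk => ?_
      by_cases hki : k = i
      · rw [hki, hyi]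
      · exact hy k (Finset.mem_erase.2 ⟨hki, hk⟩)
    · rw [apply_eq_neighbour (f := f) hi hyi fun k hk hki => hy k (Finset.mem_erase.2 ⟨hki, hk⟩), hz]
      simpa using hcon y
  have h₁ := hP.2 _ hcert
  have h₂ := Finset.card_erase_lt_of_mem hi
  omega

/-- Averaging the sensitivity over the subcube of a minimum certificate. -/
theorem IsMinCert.two_mul_card_add_le {s : ℕ} (hP : IsMinCert f z P)
    (hs1 : ∀ x, f x = true → sensAt f x ≤ 2) (hs0 : ∀ x, f x = false → sensAt f x ≤ s)
    (hz : f z = false) {K : Finset (Fin n)} (hK : K ⊆ P)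
    (hlit : ∀ i ∈ K, ¬ ∃ d b, ∀ x, neighbour f z P i x = (x d == b)) :
    2 * P.card + K.card ≤ 4 * s := by
  classical
  have hcount : ∑ i ∈ P, (Finset.univ.filter fun x => neighbour f z P i x = true).card ≤
      2 ^ n * s := by
    have hswap : ∑ i ∈ P, (Finset.univ.filter fun x => neighbour f z P i x = true).card =
        ∑ x, (P.filter fun i => neighbour f z P i x = true).card := by
      simp only [Finset.card_filter]
      exact Finset.sum_comm
    rw [hswap]
    refine le_trans (Finset.sum_le_card_nsmul _ _ s fun x _ => ?_) (by simp)
    have hx : f (P.piecewise z x) = false := by rw [hP.1.apply_piecewise, hz]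
    refine le_trans (Finset.card_le_card fun i hi => ?_) (hs0 _ hx)
    have hi' := (Finset.mem_filter.1 hi).2
    rw [neighbour] at hi'
    simp [hi', hx]
  have hlow : ∑ i ∈ P, (2 + if i ∈ K then 1 else 0) * 2 ^ n ≤
      ∑ i ∈ P, 4 * (Finset.univ.filter fun x => neighbour f z P i x = true).card := by
    refine Finset.sum_le_sum fun i hi => ?_
    have hg := neighbour_sensitivity hs1 hz hP.1 hi
    have hne := hP.exists_neighbour_eq_true hz hi
    split_ifs with hiK
    · exact (literal_or_three_quarters hg hne).resolve_left (hlit i hiK)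
    · have := two_pow_le_two_mul_card hg hne
      omega
  rw [← Finset.sum_mul, ← Finset.mul_sum, Finset.sum_add_distrib, Finset.sum_const,
    Finset.sum_ite_mem, Finset.inter_eq_right.2 hK, Finset.sum_const] at hlow
  simp only [smul_eq_mul, mul_one] at hlow
  have hpos : 0 < 2 ^ n := by positivity
  refine Nat.le_of_mul_le_mul_right ?_ hpos
  nlinarith

theorem IsMinCert.five_mul_card_le {s : ℕ} (hP : IsMinCert f z P)
    (hs1 : ∀ x, f x = true → sensAt f x ≤ 2) (hs0 : ∀ x, f x = false → sensAt f x ≤ s)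
    (hz : f z = false) : 5 * P.card ≤ 9 * s := by
  classical
  let L := P.filter fun i => ∃ d b, ∀ x, neighbour f z P i x = (x d == b)
  have hLP : L ⊆ P := Finset.filter_subset _ _
  have hex : ∀ i, ∃ d b, i ∈ L → ∀ x, neighbour f z P i x = (x d == b) := by
    intro i
    by_cases hi : i ∈ L
    · obtain ⟨d, b, h⟩ := (Finset.mem_filter.1 hi).2
      exact ⟨d, b, fun _ => h⟩
    · exact ⟨i, true, fun h => absurd h hi⟩
  choose j b hjb using hex
  have hjP : ∀ i ∈ L, j i ∉ P := fun i hi => notMem_of_neighbour_eq_literal (hjb i hi)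
  let B := L.filter fun i => b i ≠ z (j i)
  let swap : Finset (Fin n) → Finset (Fin n) := fun T => (P \ T) ∪ T.image j
  obtain ⟨T, hT, hTmax⟩ := Finset.exists_max_image (B.powerset.filter fun T => IsCert f z (swap T))
    Finset.card ⟨∅, by simp [swap, hP.1]⟩
  rw [Finset.mem_filter, Finset.mem_powerset] at hT
  obtain ⟨hTB, hTcert⟩ := hT
  have hBL : B ⊆ L := Finset.filter_subset _ _
  have hTP : T ⊆ P := hTB.trans (hBL.trans hLP)
  have hswap_card : (swap T).card ≤ P.card := by
    have h₁ := Finset.card_union_le (P \ T) (T.image j)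
    have h₂ := Finset.card_image_le (s := T) (f := j)
    have h₃ := Finset.card_sdiff_add_card_eq_card hTP
    change ((P \ T) ∪ T.image j).card ≤ _
    omega
  have hmin : IsMinCert f z (swap T) := ⟨hTcert, fun Q hQ => hswap_card.trans (hP.2 Q hQ)⟩
  let K := L.filter fun i => (b i = z (j i) ↔ j i ∈ T.image j)
  have hKT : ∀ i ∈ K, i ∉ T := by
    intro i hi hiT
    have h₁ := (Finset.mem_filter.1 hi).2
    have h₂ := (Finset.mem_filter.1 (hTB hiT)).2
    exact h₂ (h₁.2 (Finset.mem_image_of_mem j hiT))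
  have hKswap : K ⊆ swap T := by
    intro i hi
    exact Finset.mem_union_left _
      (Finset.mem_sdiff.2 ⟨hLP (Finset.mem_filter.1 hi).1, hKT i hi⟩)
  have hKlit : ∀ i ∈ K, ¬ ∃ d β, ∀ x, neighbour f z (swap T) i x = (x d == β) := by
    rintro i hi ⟨c, β, hc⟩
    have hcswap := notMem_of_neighbour_eq_literal hc
    have hiswap := hKswap hi
    have hiT := hKT i hi
    obtain ⟨hiL, hiff⟩ := Finset.mem_filter.1 hi
    have hji := hjP i hiL
    have hlit := hjb i hiL
    have hijne : j i ≠ i := fun h => hji (h.symm ▸ hLP hiL)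
    have hz₁ := hlit z
    have hz₂ := hc z
    rw [neighbour_self] at hz₁ hz₂
    have hzj := hlit (flipCoord z (j i))
    rw [neighbour_flipCoord_self hji, flipCoord_same] at hzj
    by_cases hb : b i = z (j i)
    · have hzc := hc (flipCoord z c)
      rw [neighbour_flipCoord_self hcswap, flipCoord_same] at hzc
      have hjswap : j i ∈ swap T := Finset.mem_union_right _ (hiff.1 hb)
      have htrue : f (flipCoord z i) = true := by simp [hz₁, hb]
      have hcard := card_le_two_of_sensitive hs1 htrue {i, j i, c} (by
        intro t ht
        simp only [Finset.mem_insert, Finset.mem_singleton] at ht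
        rcases ht with rfl | rfl | rfl
        · rw [flipCoord_flipCoord, hz]
        · rw [flipCoord_comm, hzj, hb]
          cases z (j i) <;> rfl
        · rw [flipCoord_comm, hzc]
          rw [htrue] at hz₂
          revert hz₂
          cases z t <;> cases β <;> simp)
      rw [Finset.card_eq_three.2 ⟨i, j i, c, hijne.symm, fun h => hcswap (h ▸ hiswap),
        fun h => hcswap (h ▸ hjswap), rfl⟩] at hcard
      omega
    · have hjT : j i ∉ T.image j := fun h => hb (hiff.2 h)
      have hjswap : j i ∉ swap T := by
        intro h
        rcases Finset.mem_union.1 h with h | h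
        · exact hji (Finset.mem_sdiff.1 h).1
        · exact hjT h
      have hzc := hc (flipCoord z (j i))
      rw [neighbour_flipCoord_self hjswap] at hzc
      have hcj : c = j i := by
        by_contra hne
        rw [flipCoord_of_ne _ hne, ← hz₂, hz₁, hzj] at hzc
        revert hzc
        cases z (j i) <;> cases b i <;> simp
      subst hcj
      have hcert : IsCert f z (swap (insert i T)) := by
        intro y hy
        have hy' : ∀ k ∈ swap T, k ≠ i → y k = z k := by
          intro k hk hki
          refine hy k ?_
          simp only [swap, Finset.mem_union, Finset.mem_sdiff, Finset.mem_insert,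
            Finset.image_insert] at hk ⊢
          tauto
        by_cases hyi : y i = z i
        · refine hTcert y fun k hk => ?_
          by_cases hki : k = i
          · rw [hki, hyi]
          · exact hy' k hk hki
        · have hyj : y (j i) = z (j i) := hy _ (by simp [swap])
          rw [apply_eq_neighbour (f := f) hiswap hyi hy', hc, hyj, ← hz₂, hz₁, hz]
          revert hb
          cases z (j i) <;> cases b i <;> simp
      have hle := hTmax (insert i T) (Finset.mem_filter.2 ⟨Finset.mem_powerset.2
        (Finset.insert_subset (Finset.mem_filter.2 ⟨hiL, hb⟩) hTB), hcert⟩)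
      rw [Finset.card_insert_of_notMem hiT] at hle
      omega
  have hpoint : L.card ≤ s + K.card := by
    let x : Fin n → Bool := fun k => if k ∈ T.image j then !(z k) else z k
    have hx : f (P.piecewise z x) = false := by rw [hP.1.apply_piecewise, hz]
    have hle : (L \ K).card ≤ s := by
      refine le_trans (Finset.card_le_card fun i hi => ?_) (hs0 _ hx)
      obtain ⟨hiL, hiK⟩ := Finset.mem_sdiff.1 hi
      have hiff : ¬ (b i = z (j i) ↔ j i ∈ T.image j) := fun h =>
        hiK (Finset.mem_filter.2 ⟨hiL, h⟩)
      have hval : neighbour f z P i x = true := by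
        rw [hjb i hiL]
        by_cases hjT : j i ∈ T.image j
        · have hb : b i ≠ z (j i) := fun h => hiff ⟨fun _ => hjT, fun _ => h⟩
          simp only [x, if_pos hjT]
          revert hb
          cases z (j i) <;> cases b i <;> simp
        · have hb : b i = z (j i) := by
            by_contra h
            exact hiff ⟨fun h' => absurd h' h, fun h' => absurd h' hjT⟩
          simp only [x, if_neg hjT, hb, beq_self_eq_true]
      rw [neighbour] at hval
      simp [hval, hx]
    have hKL : K ⊆ L := Finset.filter_subset _ _
    have := Finset.card_sdiff_add_card_eq_card hKL
    omega
  have havg := hP.two_mul_card_add_le hs1 hs0 hz (Finset.sdiff_subset : P \ L ⊆ P)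
    (fun i hi h => (Finset.mem_sdiff.1 hi).2
      (Finset.mem_filter.2 ⟨(Finset.mem_sdiff.1 hi).1, h⟩))
  have hPL := Finset.card_sdiff_add_card_eq_card hLP
  have hswap := hmin.two_mul_card_add_le hs1 hs0 hz hKswap hKlit
  have hcards := hP.2 _ hTcert
  omega

theorem exists_isMinCert_card_eq_certAt (f : (Fin n → Bool) → Bool) (z : Fin n → Bool) :
    ∃ P, IsMinCert f z P ∧ P.card = certAt f z := by
  have hne : {k | ∃ P : Finset (Fin n), P.card = k ∧
      ∀ y : Fin n → Bool, (∀ i ∈ P, y i = z i) → f y = f z}.Nonempty :=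
    ⟨_, Finset.univ, rfl, fun y hy => congrArg f (funext fun i => hy i (Finset.mem_univ i))⟩
  obtain ⟨P, hcard, hP⟩ := Nat.sInf_mem hne
  exact ⟨P, ⟨hP, fun Q hQ => hcard.trans_le (Nat.sInf_le ⟨Q, rfl, hQ⟩)⟩, hcard⟩

end Certificates

theorem sensAt_le_bSens {n : ℕ} (f : (Fin n → Bool) → Bool) {x : Fin n → Bool} {b : Bool}
    (hx : f x = b) : sensAt f x ≤ bSens f b :=
  Finset.le_sup (f := sensAt f) (by simp [hx])

/-- **Theorem 8.** If `f` is non-constant with `s₁(f) = 2`, then `C₀(f) ≤ (9/5)·s₀(f)`. -/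
theorem cert0_le_nine_fifths_sens0 {n : ℕ} (f : (Fin n → Bool) → Bool)
    (hnc : NonConstant f) (hs1 : bSens f true = 2) :
    (bCert f false : ℚ) ≤ 9 / 5 * (bSens f false : ℚ) := by
  have hle : bCert f false ≤ 9 * bSens f false / 5 := by
    refine Finset.sup_le fun z hz => ?_
    obtain ⟨P, hP, hcard⟩ := exists_isMinCert_card_eq_certAt f z
    have := hP.five_mul_card_le (fun x hx => hs1 ▸ sensAt_le_bSens f hx)
      (fun x hx => sensAt_le_bSens f hx) (Finset.mem_filter.1 hz).2
    omega
  have h : 5 * bCert f false ≤ 9 * bSens f false := by omega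
  have h' : (5 : ℚ) * bCert f false ≤ 9 * bSens f false := by exact_mod_cast h
  linarith
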